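/- arXiv:1512.01010 — 3 statements merged into one kernel-verified Lean document; each statement's English description precedes it below -/
import Mathlib

section
/- Let (z_n)_{n≥0} be a sequence of positive real numbers satisfying the three-term recurrence a(n)·z_{n+1} + b(n)·z_n + c(n)·z_{n-1} = 0 for all n ≥ 1, where a, b, c are real-valued functions of n. Suppose there exists an integer N such that for all n > N: (i) a(n) > 0; (ii) Δ_n := b(n)² − 4·a(n)·c(n) ≥ 0; and (iii) (−b(n) − √Δ_n)/(2a(n)) ≤ z_n/z_{n−1} ≤ (−b(n) + √Δ_n)/(2a(n)). Then the sequence (z_n)_{n≥N} is log-convex, i.e., z_n² ≤ z_{n−1}·z_{n+1} for all n > N. -/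
theorem new_criterion_log_convex
    (z a b c : ℕ → ℝ) (N : ℕ)
    (hz : ∀ n, 0 < z n)
    (hrec : ∀ n ≥ 1, a n * z (n + 1) + b n * z n + c n * z (n - 1) = 0)
    (ha : ∀ n > N, 0 < a n)
    (hΔ : ∀ n > N, 0 ≤ b n ^ 2 - 4 * a n * c n)
    (hbound : ∀ n > N,
      (-b n - Real.sqrt (b n ^ 2 - 4 * a n * c n)) / (2 * a n) ≤ z n / z (n - 1) ∧
      z n / z (n - 1) ≤ (-b n + Real.sqrt (b n ^ 2 - 4 * a n * c n)) / (2 * a n)) :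
    ∀ n > N, z n ^ 2 ≤ z (n - 1) * z (n + 1) := by
  intro n hn
  have hr := hrec n (by omega)
  have han := ha n hn
  have hw := hz (n - 1)
  have hs := Real.sq_sqrt (hΔ n hn)
  obtain ⟨h₁, h₂⟩ := hbound n hn
  rw [div_le_div_iff₀ (by positivity) hw] at h₁
  rw [div_le_div_iff₀ hw (by positivity)] at h₂
  set s := Real.sqrt (b n ^ 2 - 4 * a n * c n)
  have hsq : (2 * a n * z n + b n * z (n - 1)) ^ 2 ≤ (s * z (n - 1)) ^ 2 :=
    sq_le_sq' (by linarith) (by linarith)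
  rw [mul_pow, hs] at hsq
  have hquad : 4 * a n * (a n * z n ^ 2) ≤ 4 * a n * (a n * (z (n - 1) * z (n + 1))) := by
    linear_combination hsq - 4 * a n * z (n - 1) * hr
  exact le_of_mul_le_mul_left (le_of_mul_le_mul_left hquad (by positivity)) han
end

section
/- Let (z_n)_{n≥0} be a sequence of positive real numbers satisfying z_n = u(n)·z_{n−1} + v(n)·z_{n−2} for n ≥ 2, where u, v are real-valued functions with v(n) < 0 for all n ≥ 2. If there exists a nonnegative integer N and a function h(n) such that for all n ≥ N+2: (i) 3u(n)/4 ≤ z_n/z_{n−1} ≤ h(n), and (ii) h(n)⁴ − u(n)·h(n)³ − u(n+1)·v(n)·h(n) − v(n)·v(n+1) < 0, then the sequence (z_n)_{n≥N} is ratio log-concave, i.e., the sequence (z_n/z_{n−1}) is log-concave for n ≥ N+1. -/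
/-- The quartic `x ^ 4 - p * x ^ 3 + q * x` is monotone for `x ≥ 3 * p / 4`, `x ≥ 0`
when `q ≥ 0`. -/
lemma quartic_le_quartic {p q x y : ℝ} (hq : 0 ≤ q) (hx : 0 ≤ x) (hp : 3 * p / 4 ≤ x)
    (hxy : x ≤ y) : x ^ 4 - p * x ^ 3 + q * x ≤ y ^ 4 - p * y ^ 3 + q * y := by
  have hy : 0 ≤ y := hx.trans hxy
  have hpx : 0 ≤ (4 * x / 3 - p) * (y ^ 2 + y * x + x ^ 2) :=
    mul_nonneg (by linarith) (by positivity)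
  have hcub : 0 ≤ (y - x) * (y ^ 2 + 2 * x * y / 3 + x ^ 2 / 3) :=
    mul_nonneg (by linarith) (by positivity)
  have key : 0 ≤ (y - x) * ((y - x) * (y ^ 2 + 2 * x * y / 3 + x ^ 2 / 3)
      + (4 * x / 3 - p) * (y ^ 2 + y * x + x ^ 2) + q) :=
    mul_nonneg (by linarith) (by linarith)
  linarith

/-- The ratio inequality for four consecutive terms `a, b, c, d` of a second-order recurrence. -/
lemma ratio_mul_ratio_le_sq {a b c d p p' w w' t : ℝ}
    (ha : 0 < a) (hb : 0 < b) (hc : 0 < c) (hd : 0 < d)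
    (hrec : c = p * b + w * a) (hrec' : d = p' * c + w' * b) (hw : w < 0) (hw' : w' < 0)
    (hlow : 3 * p / 4 ≤ c / b) (hupp : c / b ≤ t)
    (hcond : t ^ 4 - p * t ^ 3 - p' * w * t - w * w' < 0) :
    b / a * (d / c) ≤ (c / b) ^ 2 := by
  have hp' : 0 ≤ p' := by
    by_contra! hneg
    nlinarith [mul_pos_of_neg_of_neg hneg (neg_lt_zero.mpr hc),
      mul_pos_of_neg_of_neg hw' (neg_lt_zero.mpr hb)]
  have hmono := quartic_le_quartic (q := -(p' * w))
    (by nlinarith [mul_nonneg hp' (neg_nonneg.mpr hw.le)]) (by positivity) hlow hupp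
  have hneg : (c / b) ^ 4 - p * (c / b) ^ 3 - p' * w * (c / b) - w * w' < 0 := by linarith
  have hfactor : (c / b) ^ 4 - p * (c / b) ^ 3 - p' * w * (c / b) - w * w'
      = w * (a * c ^ 3 - b ^ 3 * d) / b ^ 4 := by
    rw [hrec']
    field_simp
    linear_combination c ^ 3 * hrec
  rw [hfactor, div_neg_iff] at hneg
  have hprod : w * (a * c ^ 3 - b ^ 3 * d) < 0 := by
    rcases hneg with h | h
    · exact absurd h.2 (by have := pow_pos hb 4; linarith)
    · exact h.1
  have hdiff : 0 < a * c ^ 3 - b ^ 3 * d := pos_of_mul_neg_right hprod hw.le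
  rw [div_mul_div_comm, div_pow, div_le_div_iff₀ (by positivity) (by positivity)]
  linarith

theorem criterion_ratio_log_concave
    (z u v h : ℕ → ℝ) (N : ℕ)
    (hz : ∀ n, 0 < z n)
    (hrec : ∀ n ≥ 2, z n = u n * z (n - 1) + v n * z (n - 2))
    (hv : ∀ n ≥ 2, v n < 0)
    (hbound : ∀ n ≥ N + 2, 3 * u n / 4 ≤ z n / z (n - 1) ∧ z n / z (n - 1) ≤ h n)
    (hcond : ∀ n ≥ N + 2,
      h n ^ 4 - u n * h n ^ 3 - u (n + 1) * v n * h n - v n * v (n + 1) < 0) :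
    ∀ n ≥ N + 2,
      (z (n - 1) / z (n - 2)) * (z (n + 1) / z n) ≤ (z n / z (n - 1)) ^ 2 := by
  intro n hn
  have hrec' := hrec (n + 1) (by omega)
  rw [show n + 1 - 1 = n by omega, show n + 1 - 2 = n - 1 by omega] at hrec'
  exact ratio_mul_ratio_le_sq (hz _) (hz _) (hz _) (hz _) (hrec n (by omega)) hrec'
    (hv n (by omega)) (hv (n + 1) (by omega)) (hbound n hn).1 (hbound n hn).2 (hcond n hn)
end

section
/- Let k be a positive integer. If a sequence (z_n)_{n≥k} of positive real numbers is ratio log-concave and z_{k+1}^{1/(k+1)}/z_k^{1/k} > z_{k+2}^{1/(k+2)}/z_{k+1}^{1/(k+1)}, then the sequence (z_n^{1/n})_{n≥k} is strictly log-concave. -/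
/-- Strict log-concavity of consecutive roots, cleared of roots and denominators. -/
lemma rpow_mul_rpow_lt_sq_iff {x y w m : ℝ} (hx : 0 < x) (hy : 0 < y) (hw : 0 < w)
    (hm : 0 < m) :
    x ^ (1 / m) * w ^ (1 / (m + 2)) < (y ^ (1 / (m + 1))) ^ 2 ↔
      (m + 1) * (m + 2) * Real.log x + m * (m + 1) * Real.log w
        < 2 * m * (m + 2) * Real.log y := by
  rw [← Real.log_lt_log_iff (by positivity) (by positivity),
    Real.log_mul (by positivity) (by positivity), Real.log_pow, Real.log_rpow hx,
    Real.log_rpow hy, Real.log_rpow hw,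
    ← mul_lt_mul_iff_right₀ (show 0 < m * (m + 1) * (m + 2) by positivity)]
  have hl : m * (m + 1) * (m + 2) * (1 / m * Real.log x + 1 / (m + 2) * Real.log w) =
      (m + 1) * (m + 2) * Real.log x + m * (m + 1) * Real.log w := by
    field_simp
  have hr : m * (m + 1) * (m + 2) * ((2 : ℕ) * (1 / (m + 1) * Real.log y)) =
      2 * m * (m + 2) * Real.log y := by
    push_cast
    field_simp
  rw [hl, hr]

/-- Log-concavity of consecutive ratios bounds the third difference of logarithms. -/
lemma log_le_of_ratio_mul_le_sq {a b c d : ℝ} (ha : 0 < a) (hb : 0 < b) (hc : 0 < c)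
    (hd : 0 < d) (h : (b / a) * (d / c) ≤ (c / b) ^ 2) :
    Real.log d ≤ 3 * Real.log c - 3 * Real.log b + Real.log a := by
  have h' := Real.log_le_log (by positivity) h
  rw [Real.log_mul (by positivity) (by positivity), Real.log_pow,
    Real.log_div hb.ne' ha.ne', Real.log_div hd.ne' hc.ne', Real.log_div hc.ne' hb.ne'] at h'
  push_cast at h'
  linarith

theorem root_strictly_log_concave_of_ratio_log_concave
    (k : ℕ) (hk : 0 < k) (z : ℕ → ℝ)
    (hz : ∀ n ≥ k, 0 < z n)
    (hratio : ∀ n ≥ k + 2,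
      (z (n - 1) / z (n - 2)) * (z (n + 1) / z n) ≤ (z n / z (n - 1)) ^ 2)
    (hinit : z (k + 2) ^ ((1 : ℝ) / (k + 2)) / z (k + 1) ^ ((1 : ℝ) / (k + 1)) <
      z (k + 1) ^ ((1 : ℝ) / (k + 1)) / z k ^ ((1 : ℝ) / k)) :
    ∀ n ≥ k + 1,
      z (n - 1) ^ ((1 : ℝ) / (n - 1 : ℕ)) * z (n + 1) ^ ((1 : ℝ) / (n + 1)) <
        (z n ^ ((1 : ℝ) / n)) ^ 2 := by
  have key : ∀ m ≥ k, z m ^ ((1 : ℝ) / m) * z (m + 2) ^ ((1 : ℝ) / (m + 2)) <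
      (z (m + 1) ^ ((1 : ℝ) / (m + 1))) ^ 2 := by
    intro m hm
    induction m, hm using Nat.le_induction with
    | base =>
      have h₀ := Real.rpow_pos_of_pos (hz k le_rfl) ((1 : ℝ) / k)
      have h₁ := Real.rpow_pos_of_pos (hz (k + 1) (by lia)) ((1 : ℝ) / (k + 1))
      rw [div_lt_div_iff₀ h₁ h₀] at hinit
      linarith
    | succ m hm ih =>
      have hm₀ : (0 : ℝ) < m := by exact_mod_cast hk.trans_le hm
      have z₀ := hz m hm
      have z₁ := hz (m + 1) (by lia)
      have z₂ := hz (m + 2) (by lia)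
      have z₃ := hz (m + 3) (by lia)
      rw [rpow_mul_rpow_lt_sq_iff z₀ z₁ z₂ hm₀] at ih
      push_cast
      rw [rpow_mul_rpow_lt_sq_iff z₁ z₂ z₃ (by positivity)]
      have h := log_le_of_ratio_mul_le_sq z₀ z₁ z₂ z₃ (hratio (m + 2) (by lia))
      have h' := mul_le_mul_of_nonneg_left h
        (show (0 : ℝ) ≤ (m + 1) * (m + 2) by positivity)
      linarith
  intro n hn
  obtain ⟨m, rfl⟩ : ∃ m, n = m + 1 := ⟨n - 1, by lia⟩
  have h := key m (by lia)
  have hcast : ((m + 1 : ℕ) : ℝ) + 1 = m + 2 := by push_cast; ring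
  rw [hcast]
  simpa using h
end
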